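/- Let $p \geq 2$ be an integer and let $Y$ be a standard Gaussian random variable. For any positive integers $k_1, \ldots, k_p$, one has $\mathbb{E}\left[\prod_{j=1}^p P_{k_j}(Y)\right] \leq (p-1)^{(k_1 + \cdots + k_p)/2} \sqrt{k_1! \cdots k_p!}$, where $P_k$ denotes the $k$-th Hermite polynomial. -/

import Mathlib

open ProbabilityTheory

open MeasureTheory Polynomial in
theorem aux_integrable (q : ℝ[X]) : Integrable (fun y => q.eval y) (gaussianReal 0 1) := by
  induction q using Polynomial.induction_on' with
  | add p q hp hq => simp only [eval_add]; exact hp.add hq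
  | monomial n a =>
    simp only [eval_monomial]
    apply Integrable.const_mul
    have h := (memLp_id_gaussianReal (μ := 0) (v := 1) (n : NNReal)).integrable_norm_pow'
    rw [← integrable_norm_iff (by fun_prop)]
    simpa using h

open MeasureTheory Polynomial in
theorem aux_integrable' (q : ℝ[X]) :
    Integrable (fun y => gaussianPDFReal 0 1 y * q.eval y) := by
  have h := aux_integrable q
  rw [gaussianReal_of_var_ne_zero _ one_ne_zero,
    integrable_withDensity_iff_integrable_smul' (by fun_prop)
      (by simp [gaussianPDF])] at h
  simpa [gaussianPDF, gaussianPDFReal_nonneg] using h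

open MeasureTheory Polynomial in
theorem aux_stein (q : ℝ[X]) :
    ∫ y, (X * q - derivative q).eval y ∂(gaussianReal 0 1) = 0 := by
  rw [integral_gaussianReal_eq_integral_smul one_ne_zero]
  have hd : ∀ y, HasDerivAt (fun y => gaussianPDFReal 0 1 y * (-q).eval y)
      (gaussianPDFReal 0 1 y * (X * q - derivative q).eval y) y := by
    intro y
    have h1 : HasDerivAt (gaussianPDFReal 0 1) (gaussianPDFReal 0 1 y * (-y)) y := by
      unfold gaussianPDFReal
      have h2 : HasDerivAt (fun x : ℝ => -(x - 0) ^ 2 / (2 * ((1 : NNReal) : ℝ))) (-y) y := by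
        have := (((hasDerivAt_id y).pow 2).neg).div_const 2
        simp only [sub_zero, NNReal.coe_one, mul_one]
        refine this.congr_deriv ?_
        simp
        ring
      have := h2.exp.const_mul ((√(2 * Real.pi * ((1 : NNReal) : ℝ)))⁻¹)
      refine this.congr_deriv ?_
      ring
    refine (h1.mul ((-q).hasDerivAt y)).congr_deriv ?_
    simp
    ring
  exact integral_eq_zero_of_hasDerivAt_of_integrable hd (aux_integrable' _) (aux_integrable' _)

open Polynomial in
noncomputable def auxH (n : ℕ) : ℝ[X] := (hermite n).map (Int.castRingHom ℝ)

open Polynomial in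
theorem auxH_succ (n : ℕ) : auxH (n + 1) = X * auxH n - derivative (auxH n) := by
  simp [auxH, hermite_succ, derivative_map]

open Polynomial in
theorem auxH_deriv (n : ℕ) : derivative (auxH n) = C (n : ℝ) * auxH (n - 1) := by
  induction n with
  | zero => simp [auxH]
  | succ n ih =>
    rw [auxH_succ, derivative_sub, derivative_mul, ih]
    cases n with
    | zero => simp
    | succ m =>
      simp only [Nat.add_sub_cancel, derivative_mul, derivative_C, derivative_X]
      rw [show auxH (m + 1) = X * auxH m - derivative (auxH m) from auxH_succ m]
      push_cast
      simp only [C_add, C_1]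
      ring

open MeasureTheory Polynomial in
theorem aux_parts (n : ℕ) (f : ℝ[X]) :
    ∫ y, (auxH (n + 1) * f).eval y ∂(gaussianReal 0 1)
      = ∫ y, (auxH n * derivative f).eval y ∂(gaussianReal 0 1) := by
  have h := aux_stein (auxH n * f)
  have e : X * (auxH n * f) - derivative (auxH n * f)
      = auxH (n + 1) * f - auxH n * derivative f := by
    rw [auxH_succ, derivative_mul]; ring
  rw [e] at h
  simp only [eval_sub] at h
  rw [integral_sub (aux_integrable _) (aux_integrable _)] at h
  linarith

open MeasureTheory Polynomial in
theorem aux_main (p : ℕ) (hp : 2 ≤ p) (s : ℕ) : ∀ k : Fin p → ℕ, ∑ j, k j = s →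
    ∫ y, (∏ j, auxH (k j)).eval y ∂(gaussianReal 0 1)
      ≤ √((p : ℝ) - 1) ^ s * √(∏ j, ((k j).factorial : ℝ)) := by
  induction s using Nat.strong_induction_on with
  | _ s ih =>
  intro k hs
  have hp1 : (0 : ℝ) ≤ (p : ℝ) - 1 := by
    have : (2 : ℝ) ≤ p := by exact_mod_cast hp
    linarith
  have : Nonempty (Fin p) := ⟨⟨0, by omega⟩⟩
  obtain ⟨i, hi⟩ := Finite.exists_max k
  rcases Nat.eq_zero_or_pos (k i) with h0 | hpos
  · have hk0 : ∀ j, k j = 0 := fun j => by have := hi j; omega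
    have : s = 0 := by rw [← hs]; simp [hk0]
    subst this
    simp [hk0, auxH]
  obtain ⟨n, hn⟩ : ∃ n, k i = n + 1 := ⟨k i - 1, by omega⟩
  set E := (Finset.univ : Finset (Fin p)).erase i with hE
  have hprod : ∏ j, auxH (k j) = auxH (n + 1) * ∏ j ∈ E, auxH (k j) := by
    rw [← hn, hE, Finset.mul_prod_erase Finset.univ (fun j => auxH (k j)) (Finset.mem_univ i)]
  rw [hprod, aux_parts, derivative_prod_finset, Finset.mul_sum]
  simp only [eval_finsetSum]
  rw [integral_finsetSum _ (fun j _ => aux_integrable _)]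
  have hcard : (E.card : ℝ) = (p : ℝ) - 1 := by
    rw [hE, Finset.card_erase_of_mem (Finset.mem_univ i)]
    simp [Nat.cast_sub (show 1 ≤ p by omega)]
  have hterm : ∀ j ∈ E, ((p : ℝ) - 1) * ∫ y, (auxH n * ((∏ l ∈ E.erase j, auxH (k l)) *
      derivative (auxH (k j)))).eval y ∂(gaussianReal 0 1)
      ≤ √((p : ℝ) - 1) ^ s * √(∏ j, ((k j).factorial : ℝ)) := by
    intro j hj
    have hji : j ≠ i := Finset.ne_of_mem_erase hj
    rw [auxH_deriv]
    rcases Nat.eq_zero_or_pos (k j) with h0 | hposj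
    · simp only [h0, Nat.cast_zero, C_0, zero_mul, mul_zero, eval_zero, integral_zero]
      positivity
    obtain ⟨m, hm⟩ : ∃ m, k j = m + 1 := ⟨k j - 1, by omega⟩
    let k' : Fin p → ℕ := fun l => if l = i then n else if l = j then m else k l
    have hki : k' i = n := by simp [k']
    have hkj : k' j = m := by simp [k', hji]
    have hkl : ∀ l ∈ E.erase j, k' l = k l := by
      intro l hl
      have h1 := Finset.ne_of_mem_erase hl
      have h2 := Finset.ne_of_mem_erase (Finset.mem_of_mem_erase hl)
      simp [k', h1, h2]
    have hP : ∀ {M : Type} [CommMonoid M] (f : Fin p → M),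
        ∏ l, f l = f i * (f j * ∏ l ∈ E.erase j, f l) := by
      intro M _ f
      rw [Finset.mul_prod_erase E f hj, hE, Finset.mul_prod_erase _ f (Finset.mem_univ i)]
    have hS : ∀ f : Fin p → ℕ, ∑ l, f l = f i + (f j + ∑ l ∈ E.erase j, f l) := by
      intro f
      rw [Finset.add_sum_erase E f hj, hE, Finset.add_sum_erase _ f (Finset.mem_univ i)]
    have hs' : ∑ l, k' l + 2 = s := by
      rw [← hs, hS k', hS k, hki, hkj, hn, hm, Finset.sum_congr rfl hkl]; ring
    have hI := ih (∑ l, k' l) (by omega) k' rfl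
    have e1 : auxH n * ((∏ l ∈ E.erase j, auxH (k l)) * (C ((k j : ℕ) : ℝ) * auxH (k j - 1)))
        = C ((k j : ℕ) : ℝ) * ∏ l, auxH (k' l) := by
      rw [hP (fun l => auxH (k' l)), hki, hkj, hm, Nat.add_sub_cancel,
        Finset.prod_congr rfl (fun l hl => by rw [← hkl l hl])]
      ring
    rw [e1]
    simp only [eval_mul, eval_C]
    rw [integral_const_mul]
    have hF : ∏ l, ((k l).factorial : ℝ) = (k i : ℝ) * k j * ∏ l, ((k' l).factorial : ℝ) := by
      rw [hP (fun l => ((k' l).factorial : ℝ)), hP (fun l => ((k l).factorial : ℝ)), hki, hkj,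
        Finset.prod_congr rfl (fun l hl => by rw [← hkl l hl]), hn, hm, Nat.factorial_succ,
        Nat.factorial_succ]
      push_cast
      ring
    have hsq : (k j : ℝ) ≤ √((k i : ℝ) * k j) := by
      apply Real.le_sqrt_of_sq_le
      have : (k j : ℝ) ≤ k i := by exact_mod_cast hi j
      rw [sq]
      gcongr
    rw [hF, Real.sqrt_mul (by positivity), ← hs', pow_add, Real.sq_sqrt hp1]
    calc ((p : ℝ) - 1) * ((k j : ℝ) * ∫ y, (∏ l, auxH (k' l)).eval y ∂(gaussianReal 0 1))
        ≤ ((p : ℝ) - 1) * ((k j : ℝ) *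
          (√((p : ℝ) - 1) ^ (∑ l, k' l) * √(∏ j, ((k' j).factorial : ℝ)))) := by gcongr
      _ ≤ ((p : ℝ) - 1) * (√((k i : ℝ) * k j) *
          (√((p : ℝ) - 1) ^ (∑ l, k' l) * √(∏ j, ((k' j).factorial : ℝ)))) := by gcongr
      _ = _ := by ring
  have hp2 : (0 : ℝ) < (p : ℝ) - 1 := by
    have : (2 : ℝ) ≤ p := by exact_mod_cast hp
    linarith
  have := Finset.sum_le_card_nsmul E _ _ hterm
  rw [← Finset.mul_sum, nsmul_eq_mul, hcard] at this
  exact le_of_mul_le_mul_left this hp2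

theorem stmt14 (p : ℕ) (hp : 2 ≤ p) (k : Fin p → ℕ) (hk : ∀ j, 1 ≤ k j) :
    ∫ y, ∏ j : Fin p, (Polynomial.aeval y (Polynomial.hermite (k j)) : ℝ)
        ∂(gaussianReal 0 1)
      ≤ ((p : ℝ) - 1) ^ (((∑ j, k j : ℕ) : ℝ) / 2) *
          Real.sqrt (∏ j, ((k j).factorial : ℝ)) := by
  have h := aux_main p hp _ k rfl
  have hp1 : (0 : ℝ) ≤ (p : ℝ) - 1 := by
    have : (2 : ℝ) ≤ p := by exact_mod_cast hp
    linarith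
  have e : ((p : ℝ) - 1) ^ (((∑ j, k j : ℕ) : ℝ) / 2) = √((p : ℝ) - 1) ^ (∑ j, k j) := by
    rw [Real.sqrt_eq_rpow, ← Real.rpow_natCast, ← Real.rpow_mul hp1]
    congr 1
    ring
  rw [e]
  refine le_trans (le_of_eq ?_) h
  congr 1
  ext y
  rw [Polynomial.eval_prod]
  refine Finset.prod_congr rfl fun j _ => ?_
  rw [auxH, Polynomial.eval_map, Polynomial.aeval_def]
  rfl
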